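/- Let n, m be positive integers. For all f, g ∈ C[0,1], the following Grüss-type inequality holds for the composite Bernstein quadrature: |I_{n,m}(f·g) - I_{n,m}(f)·I_{n,m}(g)| ≤ (1/4)·ω̃(f; 2√(1/12 + 1/(6m²n)))·ω̃(g; 2√(1/12 + 1/(6m²n))). -/

import Mathlib

open Set Finset

noncomputable section

/-- First order modulus of continuity of `f` on `[a,b]`. -/
def omega1 (a b : ℝ) (f : ℝ → ℝ) (t : ℝ) : ℝ :=
  sSup {v | ∃ x ∈ Set.Icc a b, ∃ y ∈ Set.Icc a b, |x - y| ≤ t ∧ v = |f x - f y|}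

/-- Least concave majorant of the first order modulus of continuity on `[0,1]`. -/
def omegaTilde (f : ℝ → ℝ) (t : ℝ) : ℝ :=
  if t ≤ 1 then
    sSup {v | ∃ x y : ℝ, 0 ≤ x ∧ x ≤ t ∧ t ≤ y ∧ y ≤ 1 ∧ x ≠ y ∧
      v = ((t - x) * omega1 0 1 f y + (y - t) * omega1 0 1 f x) / (y - x)}
  else omega1 0 1 f 1

/-- The composite Bernstein quadrature functional `I_{n,m}`. -/
def quadI (n m : ℕ) (f : ℝ → ℝ) : ℝ :=
  (1 / ((m : ℝ) * ((n : ℝ) + 1))) * ∑ k ∈ Finset.Icc 1 m, ∑ i ∈ Finset.range (n + 1),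
    f (((k : ℝ) * n - n + i) / ((m : ℝ) * n))

open scoped BigOperators

/-- Covariance of `f` and `g` under the uniform distribution on `s`. -/
def uniformCov {ι : Type*} (s : Finset ι) (f g : ι → ℝ) : ℝ :=
  𝔼 i ∈ s, f i * g i - (𝔼 i ∈ s, f i) * 𝔼 i ∈ s, g i

section Covariance

variable {ι : Type*} {s : Finset ι}

theorem expect_sub_mul_sub (hs : s.Nonempty) (f g : ι → ℝ) (a b : ℝ) :
    𝔼 i ∈ s, (f i - a) * (g i - b) =
      uniformCov s f g + (𝔼 i ∈ s, f i - a) * (𝔼 i ∈ s, g i - b) := by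
  have h : ∀ i, (f i - a) * (g i - b) = f i * g i - f i * b - a * g i + a * b := fun i => by ring
  simp only [h, uniformCov, expect_add_distrib, expect_sub_distrib, ← expect_mul, ← mul_expect,
    expect_const hs]
  ring

theorem uniformCov_eq_expect (hs : s.Nonempty) (f g : ι → ℝ) :
    uniformCov s f g =
      𝔼 i ∈ s, (f i - 𝔼 j ∈ s, f j) * (g i - 𝔼 j ∈ s, g j) := by
  rw [expect_sub_mul_sub hs]
  ring

theorem uniformCov_self_le (hs : s.Nonempty) (f : ι → ℝ) (c : ℝ) :
    uniformCov s f f ≤ 𝔼 i ∈ s, (f i - c) ^ 2 := by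
  simp only [pow_two]
  rw [expect_sub_mul_sub hs]
  linarith [mul_self_nonneg (𝔼 i ∈ s, f i - c)]

theorem uniformCov_sq_le (hs : s.Nonempty) (f g : ι → ℝ) :
    uniformCov s f g ^ 2 ≤ uniformCov s f f * uniformCov s g g := by
  simp only [uniformCov_eq_expect hs, ← pow_two]
  exact expect_mul_sq_le_sq_mul_sq _ _ _

theorem abs_uniformCov_le (hs : s.Nonempty) {f g : ι → ℝ} {A B : ℝ} (hA : 0 ≤ A) (hB : 0 ≤ B)
    (hf : uniformCov s f f ≤ A ^ 2) (hg : uniformCov s g g ≤ B ^ 2) :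
    |uniformCov s f g| ≤ A * B := by
  have hg0 : 0 ≤ uniformCov s g g := by
    rw [uniformCov_eq_expect hs]
    exact expect_nonneg fun i _ => mul_self_nonneg _
  refine abs_le_of_sq_le_sq ?_ (by positivity)
  calc _ ≤ _ := uniformCov_sq_le hs f g
    _ ≤ A ^ 2 * B ^ 2 := by gcongr
    _ = _ := by ring

theorem uniformCov_add_self_le (hs : s.Nonempty) {f g : ι → ℝ} {A B : ℝ} (hA : 0 ≤ A) (hB : 0 ≤ B)
    (hf : uniformCov s f f ≤ A ^ 2) (hg : uniformCov s g g ≤ B ^ 2) :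
    uniformCov s (fun i => f i + g i) (fun i => f i + g i) ≤ (A + B) ^ 2 := by
  have h := le_of_abs_le (abs_uniformCov_le hs hA hB hf hg)
  have e : uniformCov s (fun i => f i + g i) (fun i => f i + g i) =
      uniformCov s f f + 2 * uniformCov s f g + uniformCov s g g := by
    have h : ∀ i, (f i + g i) * (f i + g i) = f i * f i + 2 * (f i * g i) + g i * g i :=
      fun i => by ring
    simp only [uniformCov, h, expect_add_distrib, ← mul_expect]
    ring
  rw [e]
  linarith [add_sq A B]

theorem uniformCov_self_le_of_abs_sub_le (hs : s.Nonempty) {f : ι → ℝ} {A c : ℝ}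
    (h : ∀ i ∈ s, |f i - c| ≤ A) : uniformCov s f f ≤ A ^ 2 := by
  refine (uniformCov_self_le hs f c).trans ?_
  refine expect_le hs fun i hi => ?_
  rw [← sq_abs]
  gcongr
  exact h i hi

theorem uniformCov_comp_self_le (hs : s.Nonempty) {g : ℝ → ℝ} {b : ℝ}
    (hg : ∀ x y, |g x - g y| ≤ b * |x - y|) (p : ι → ℝ) :
    uniformCov s (fun i => g (p i)) (fun i => g (p i)) ≤ b ^ 2 * uniformCov s p p := by
  refine (uniformCov_self_le hs _ (g (𝔼 i ∈ s, p i))).trans ?_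
  rw [uniformCov_eq_expect hs p p, mul_expect]
  refine expect_le_expect fun i _ => ?_
  rw [← sq_abs, ← pow_two, ← sq_abs (p i - _), ← mul_pow]
  gcongr
  exact hg _ _

end Covariance

section Modulus

variable {f : ℝ → ℝ}

theorem bddAbove_omega1_set {a b : ℝ} (hf : ContinuousOn f (Set.Icc a b)) (t : ℝ) :
    BddAbove {v | ∃ x ∈ Set.Icc a b, ∃ y ∈ Set.Icc a b, |x - y| ≤ t ∧ v = |f x - f y|} := by
  obtain ⟨C, hC⟩ := isCompact_Icc.exists_bound_of_continuousOn hf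
  refine ⟨C + C, ?_⟩
  rintro _ ⟨x, hx, y, hy, -, rfl⟩
  exact (abs_sub _ _).trans (add_le_add (hC x hx) (hC y hy))

theorem abs_sub_le_omega1 {a b t x y : ℝ} (hf : ContinuousOn f (Set.Icc a b))
    (hx : x ∈ Set.Icc a b) (hy : y ∈ Set.Icc a b) (h : |x - y| ≤ t) :
    |f x - f y| ≤ omega1 a b f t :=
  le_csSup (bddAbove_omega1_set hf t) ⟨x, hx, y, hy, h, rfl⟩

theorem omega1_nonneg (a b : ℝ) (f : ℝ → ℝ) (t : ℝ) : 0 ≤ omega1 a b f t := by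
  refine Real.sSup_nonneg ?_
  rintro _ ⟨x, -, y, -, -, rfl⟩
  exact abs_nonneg _

theorem omega1_zero (a b : ℝ) (f : ℝ → ℝ) : omega1 a b f 0 = 0 := by
  refine le_antisymm (Real.sSup_le ?_ le_rfl) (omega1_nonneg a b f 0)
  rintro _ ⟨x, -, y, -, h, rfl⟩
  rw [sub_eq_zero.1 (abs_nonpos_iff.1 h)]
  simp

theorem omega1_mono {a b s t : ℝ} (hf : ContinuousOn f (Set.Icc a b)) (h : s ≤ t) :
    omega1 a b f s ≤ omega1 a b f t := by
  refine Real.sSup_le ?_ (omega1_nonneg a b f t)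
  rintro _ ⟨x, hx, y, hy, hxy, rfl⟩
  exact abs_sub_le_omega1 hf hx hy (hxy.trans h)

theorem chord_le_omegaTilde (hf : ContinuousOn f (Set.Icc 0 1)) {t x y : ℝ} (ht : t ≤ 1)
    (hx : 0 ≤ x) (hxt : x ≤ t) (hty : t ≤ y) (hy : y ≤ 1) (hxy : x ≠ y) :
    ((t - x) * omega1 0 1 f y + (y - t) * omega1 0 1 f x) / (y - x) ≤ omegaTilde f t := by
  rw [omegaTilde, if_pos ht]
  refine le_csSup ⟨omega1 0 1 f 1, ?_⟩ ⟨x, y, hx, hxt, hty, hy, hxy, rfl⟩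
  rintro _ ⟨x, y, hx, hxt, hty, hy, hxy, rfl⟩
  have hlt : x < y := lt_of_le_of_ne (hxt.trans hty) hxy
  rw [div_le_iff₀ (sub_pos.2 hlt)]
  have h1 := mul_le_mul_of_nonneg_left (omega1_mono hf hy) (sub_nonneg.2 hxt)
  have h2 := mul_le_mul_of_nonneg_left (omega1_mono hf (hlt.le.trans hy)) (sub_nonneg.2 hty)
  linarith

/-- The least concave majorant is realised at every `t > 0` by a nondecreasing affine majorant. -/
theorem exists_affine_majorant (hf : ContinuousOn f (Set.Icc 0 1)) {t : ℝ} (ht : 0 < t) :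
    ∃ a b : ℝ, 0 ≤ a ∧ 0 ≤ b ∧ a + b * t = omegaTilde f t ∧
      ∀ r, 0 ≤ r → r ≤ 1 → omega1 0 1 f r ≤ a + b * r := by
  rcases lt_or_ge 1 t with h1 | h1
  · refine ⟨omega1 0 1 f 1, 0, omega1_nonneg _ _ _ _, le_rfl, ?_, fun r _ hr => ?_⟩
    · simp [omegaTilde, h1.not_ge]
    · simpa using omega1_mono hf hr
  set M := omegaTilde f t with hM
  have htM : omega1 0 1 f t ≤ M := by
    rcases h1.eq_or_lt with rfl | h
    · simpa using chord_le_omegaTilde hf h1 le_rfl zero_le_one le_rfl le_rfl zero_ne_one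
    · have := chord_le_omegaTilde hf h1 ht.le le_rfl h.le le_rfl h.ne
      rwa [sub_self, zero_mul, zero_add, mul_div_cancel_left₀ _ (sub_pos.2 h).ne'] at this
  have hslope : ∀ x ∈ Set.Ico 0 t, 0 ≤ (M - omega1 0 1 f x) / (t - x) := fun x hx =>
    div_nonneg (sub_nonneg.2 ((omega1_mono hf hx.2.le).trans htM)) (sub_nonneg.2 hx.2.le)
  set S := (fun x => (M - omega1 0 1 f x) / (t - x)) '' Set.Ico 0 t
  have hne : S.Nonempty := ⟨_, 0, ⟨le_rfl, ht⟩, rfl⟩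
  have hbdd : BddBelow S := ⟨0, by rintro _ ⟨x, hx, rfl⟩; exact hslope x hx⟩
  have hleft : ∀ x ∈ Set.Ico 0 t, sInf S * (t - x) ≤ M - omega1 0 1 f x := fun x hx =>
    (le_div_iff₀ (sub_pos.2 hx.2)).1 (csInf_le hbdd ⟨x, hx, rfl⟩)
  refine ⟨M - sInf S * t, sInf S, ?_, ?_, by ring, fun r hr0 hr1 => ?_⟩
  · have := hleft 0 ⟨le_rfl, ht⟩
    rw [omega1_zero] at this
    linarith
  · exact le_csInf hne (by rintro _ ⟨x, hx, rfl⟩; exact hslope x hx)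
  rcases lt_trichotomy r t with h | rfl | h
  · linarith [hleft r ⟨hr0, h⟩]
  · linarith
  · have hle : (omega1 0 1 f r - M) / (r - t) ≤ sInf S := by
      refine le_csInf hne ?_
      rintro _ ⟨x, hx, rfl⟩
      have hc := chord_le_omegaTilde hf h1 hx.1 hx.2.le h.le hr1 (hx.2.trans h).ne
      rw [← hM, div_le_iff₀ (sub_pos.2 (hx.2.trans h))] at hc
      rw [div_le_div_iff₀ (sub_pos.2 h) (sub_pos.2 hx.2)]
      linarith
    rw [div_le_iff₀ (sub_pos.2 h)] at hle
    linarith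

/-- Infimal convolution with `b * |·|` approximates `f` to within `a / 2` by a `b`-Lipschitz map. -/
theorem exists_lipschitz_approx {a b : ℝ} (hf : ContinuousOn f (Set.Icc 0 1)) (hb : 0 ≤ b)
    (h : ∀ x ∈ Set.Icc (0 : ℝ) 1, ∀ y ∈ Set.Icc (0 : ℝ) 1, |f x - f y| ≤ a + b * |x - y|) :
    ∃ g : ℝ → ℝ, (∀ x y, |g x - g y| ≤ b * |x - y|) ∧
      ∀ x ∈ Set.Icc (0 : ℝ) 1, |f x - g x - a / 2| ≤ a / 2 := by
  obtain ⟨C, hC⟩ := isCompact_Icc.exists_bound_of_continuousOn hf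
  have hbdd : ∀ x : ℝ, BddBelow (Set.range fun y : Set.Icc (0 : ℝ) 1 => f y + b * |x - y|) := by
    refine fun x => ⟨-C, ?_⟩
    rintro _ ⟨y, rfl⟩
    have := neg_le_of_abs_le (hC y y.2)
    have := mul_nonneg hb (abs_nonneg (x - (y : ℝ)))
    dsimp only
    linarith
  have hlip : ∀ x y : ℝ, (⨅ z : Set.Icc (0 : ℝ) 1, f z + b * |x - z|) - b * |x - y| ≤
      ⨅ z : Set.Icc (0 : ℝ) 1, f z + b * |y - z| := fun x y => by
    refine le_ciInf fun z => ?_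
    have h1 := ciInf_le (hbdd x) z
    have h2 := mul_le_mul_of_nonneg_left (abs_sub_le x y (z : ℝ)) hb
    linarith
  refine ⟨fun x => ⨅ z : Set.Icc (0 : ℝ) 1, f z + b * |x - z|, fun x y => ?_, fun x hx => ?_⟩
  · have h1 := hlip x y
    have h2 := hlip y x
    rw [abs_sub_comm y x] at h2
    exact abs_le.2 ⟨by linarith, by linarith⟩
  · have h1 := ciInf_le (hbdd x) ⟨x, hx⟩
    have h2 : f x - a ≤ ⨅ z : Set.Icc (0 : ℝ) 1, f z + b * |x - z| :=
      le_ciInf fun z => by linarith [le_of_abs_le (h x hx z z.2)]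
    simp only [sub_self, abs_zero, mul_zero, add_zero] at h1
    exact abs_le.2 ⟨by linarith, by linarith⟩

theorem uniformCov_self_le_omegaTilde {ι : Type*} {s : Finset ι} (hs : s.Nonempty)
    (hf : ContinuousOn f (Set.Icc 0 1)) {p : ι → ℝ} (hp : ∀ i ∈ s, p i ∈ Set.Icc (0 : ℝ) 1)
    {σ : ℝ} (hσ : 0 < σ) (hvar : uniformCov s p p ≤ σ ^ 2) :
    0 ≤ omegaTilde f (2 * σ) ∧
      uniformCov s (fun i => f (p i)) (fun i => f (p i)) ≤ (omegaTilde f (2 * σ) / 2) ^ 2 := by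
  obtain ⟨a, b, ha, hb, hab, hmaj⟩ := exists_affine_majorant hf (t := 2 * σ) (by positivity)
  refine ⟨by rw [← hab]; positivity, ?_⟩
  obtain ⟨g, hg, hfg⟩ := exists_lipschitz_approx (a := a) hf hb fun x hx y hy =>
    (abs_sub_le_omega1 hf hx hy le_rfl).trans (hmaj _ (abs_nonneg _)
      (abs_le.2 ⟨by linarith [hx.1, hy.2], by linarith [hx.2, hy.1]⟩))
  have h := uniformCov_add_self_le hs (div_nonneg ha zero_le_two) (mul_nonneg hb hσ.le)
    (uniformCov_self_le_of_abs_sub_le hs fun i hi => hfg (p i) (hp i hi))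
    ((uniformCov_comp_self_le hs hg p).trans
      ((mul_le_mul_of_nonneg_left hvar (sq_nonneg b)).trans_eq (mul_pow b σ 2).symm))
  simp only [sub_add_cancel] at h
  refine h.trans_eq ?_
  rw [← hab]
  ring

end Modulus

section Nodes

/-- Index set of the nodes of `quadI n m`. -/
def quadIndex (n m : ℕ) : Finset (ℕ × ℕ) := Finset.Icc 1 m ×ˢ Finset.range (n + 1)

/-- Nodes of `quadI n m`. -/
def quadNode (n m : ℕ) (q : ℕ × ℕ) : ℝ := ((q.1 : ℝ) * n - n + q.2) / ((m : ℝ) * n)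

theorem quadI_eq_expect (n m : ℕ) (f : ℝ → ℝ) :
    quadI n m f = 𝔼 q ∈ quadIndex n m, f (quadNode n m q) := by
  rw [expect_eq_sum_div_card, quadIndex, sum_product, card_product, quadI]
  simp [quadNode, div_eq_inv_mul]

theorem quadIndex_nonempty {m : ℕ} (n : ℕ) (hm : 0 < m) : (quadIndex n m).Nonempty :=
  ⟨(1, 0), by simp [quadIndex]; omega⟩

theorem quadNode_mem_Icc {n m : ℕ} (hn : 0 < n) (hm : 0 < m) {q : ℕ × ℕ}
    (hq : q ∈ quadIndex n m) : quadNode n m q ∈ Set.Icc (0 : ℝ) 1 := by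
  simp only [quadIndex, mem_product, Finset.mem_Icc, Finset.mem_range, Nat.lt_succ_iff] at hq
  obtain ⟨⟨h1, h2⟩, h3⟩ := hq
  have h1' : (1 : ℝ) ≤ q.1 := by exact_mod_cast h1
  have h2' : (q.1 : ℝ) ≤ m := by exact_mod_cast h2
  have h3' : (q.2 : ℝ) ≤ n := by exact_mod_cast h3
  have hn' : (0 : ℝ) < n := by exact_mod_cast hn
  have hm' : (0 : ℝ) < m := by exact_mod_cast hm
  have h4 := mul_le_mul_of_nonneg_right h1' hn'.le
  have h5 := mul_le_mul_of_nonneg_right h2' hn'.le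
  have h6 : (0 : ℝ) ≤ q.2 := by positivity
  exact ⟨div_nonneg (by linarith) (by positivity), (div_le_one (by positivity)).2 (by linarith)⟩

theorem sum_range_succ_cast (n : ℕ) :
    ∑ i ∈ Finset.range (n + 1), (i : ℝ) = n * (n + 1) / 2 := by
  induction n with
  | zero => simp
  | succ k ih => rw [sum_range_succ, ih]; push_cast; ring

theorem sum_range_succ_cast_sq (n : ℕ) :
    ∑ i ∈ Finset.range (n + 1), (i : ℝ) ^ 2 = n * (n + 1) * (2 * n + 1) / 6 := by
  induction n with
  | zero => simp
  | succ k ih => rw [sum_range_succ, ih]; push_cast; ring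

theorem expect_quadNode {n m : ℕ} (hn : 0 < n) (hm : 0 < m) :
    𝔼 q ∈ quadIndex n m, quadNode n m q = 1 / 2 := by
  have hn' : (n : ℝ) ≠ 0 := by positivity
  have hm' : (m : ℝ) ≠ 0 := by positivity
  have hn1 : (n : ℝ) + 1 ≠ 0 := by positivity
  have inner : ∀ k : ℕ, ∑ i ∈ Finset.range (n + 1), quadNode n m (k, i) =
      (n + 1) * (2 * k - 1) / (2 * m) := fun k => by
    simp only [quadNode, ← Finset.sum_div, sum_add_distrib, sum_range_succ_cast, sum_const,
      card_range, nsmul_eq_mul]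
    push_cast
    field_simp
    ring
  have outer : ∀ l : ℕ, ∑ k ∈ Finset.Icc 1 l, (2 * (k : ℝ) - 1) = l ^ 2 := fun l => by
    induction l with
    | zero => simp
    | succ j ih => rw [sum_Icc_succ_top (by omega), ih]; push_cast; ring
  rw [expect_eq_sum_div_card, quadIndex, sum_product, card_product]
  simp only [inner, ← Finset.sum_div, ← Finset.mul_sum, outer, card_range, Nat.card_Icc]
  push_cast [Nat.add_sub_cancel]
  field_simp

theorem expect_quadNode_sq {n m : ℕ} (hn : 0 < n) (hm : 0 < m) :
    𝔼 q ∈ quadIndex n m, quadNode n m q * quadNode n m q =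
      1 / 3 + 1 / (6 * (m : ℝ) ^ 2 * n) := by
  have hn' : (n : ℝ) ≠ 0 := by positivity
  have hm' : (m : ℝ) ≠ 0 := by positivity
  have hn1 : (n : ℝ) + 1 ≠ 0 := by positivity
  have inner : ∀ k : ℕ, ∑ i ∈ Finset.range (n + 1), quadNode n m (k, i) * quadNode n m (k, i) =
      (n + 1) / m ^ 2 * ((3 * (k : ℝ) ^ 2 - 3 * k + 1) / 3 + 1 / (6 * n)) := fun k => by
    have e : ∀ i : ℕ, quadNode n m (k, i) * quadNode n m (k, i) =
        (((k : ℝ) * n - n) ^ 2 + 2 * (k * n - n) * i + (i : ℝ) ^ 2) / (m * n) ^ 2 := fun i => by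
      simp only [quadNode]
      ring
    simp only [e, ← Finset.sum_div, sum_add_distrib, ← Finset.mul_sum, sum_range_succ_cast,
      sum_range_succ_cast_sq, sum_const, card_range, nsmul_eq_mul]
    push_cast
    field_simp
    ring
  have outer : ∀ l : ℕ, ∑ k ∈ Finset.Icc 1 l, ((3 * (k : ℝ) ^ 2 - 3 * k + 1) / 3 + 1 / (6 * n)) =
      (l : ℝ) ^ 3 / 3 + l / (6 * n) := fun l => by
    induction l with
    | zero => simp
    | succ j ih => rw [sum_Icc_succ_top (by omega), ih]; push_cast; ring
  rw [expect_eq_sum_div_card, quadIndex, sum_product, card_product]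
  simp only [inner, ← Finset.mul_sum, outer, card_range, Nat.card_Icc]
  push_cast [Nat.add_sub_cancel]
  field_simp

theorem uniformCov_quadNode {n m : ℕ} (hn : 0 < n) (hm : 0 < m) :
    uniformCov (quadIndex n m) (quadNode n m) (quadNode n m) =
      1 / 12 + 1 / (6 * (m : ℝ) ^ 2 * n) := by
  rw [uniformCov, expect_quadNode hn hm, expect_quadNode_sq hn hm]
  ring

end Nodes

theorem gruss_quadrature
    (n m : ℕ) (hn : 0 < n) (hm : 0 < m)
    (f g : ℝ → ℝ) (hf : ContinuousOn f (Set.Icc 0 1)) (hg : ContinuousOn g (Set.Icc 0 1)) :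
    |quadI n m (fun t => f t * g t) - quadI n m f * quadI n m g| ≤
      1 / 4 *
        omegaTilde f (2 * Real.sqrt (1 / 12 + 1 / (6 * (m : ℝ) ^ 2 * (n : ℝ)))) *
        omegaTilde g (2 * Real.sqrt (1 / 12 + 1 / (6 * (m : ℝ) ^ 2 * (n : ℝ)))) := by
  have hpos : 0 < 1 / 12 + 1 / (6 * (m : ℝ) ^ 2 * (n : ℝ)) := by positivity
  have hs := quadIndex_nonempty n hm
  have hvar := ((uniformCov_quadNode hn hm).trans (Real.sq_sqrt hpos.le).symm).le
  obtain ⟨hf0, hf2⟩ := uniformCov_self_le_omegaTilde hs hf (fun _ => quadNode_mem_Icc hn hm)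
    (Real.sqrt_pos.2 hpos) hvar
  obtain ⟨hg0, hg2⟩ := uniformCov_self_le_omegaTilde hs hg (fun _ => quadNode_mem_Icc hn hm)
    (Real.sqrt_pos.2 hpos) hvar
  simp only [quadI_eq_expect]
  refine (abs_uniformCov_le hs (div_nonneg hf0 zero_le_two) (div_nonneg hg0 zero_le_two)
    hf2 hg2).trans_eq ?_
  ring
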